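/- (Two-stage consistency lemma, the induction step of Proposition 1.) Let S₁ ⊆ S be a subset such that for every s ∈ S₁ and a, either f(s,a) ∈ S₁ or f(s,a) ∉ S₁ (the latter is a stage transition). For an initial state s ∈ S₁ and action sequence a : ℕ → A with trajectory s_0 = s, s_{t+1} = f(s_t, a_t), let T(s,a) = inf{ t : s_t ∉ S₁ } be the stage-transition time (possibly ∞), and define the stage-1 return G₁(s,a) = ∑_{t < T} γ^t R(s_{t+1}, a_t) + γ^T V*(s_T) when T < ∞, and G₁(s,a) = G(s,a) when T = ∞. Define Q*₁(s, a₀) = ⨆ { G₁(s, a) : a is an action sequence with a(0) = a₀ }. Then for every s ∈ S₁ and every action a₀, Q*₁(s, a₀) = Q*(s, a₀). -/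

import Mathlib

/-- The controlled trajectory: `traj f s a 0 = s` and
`traj f s a (t+1) = f (traj f s a t) (a t)`. -/
def traj {S A : Type*} (f : S → A → S) (s : S) (a : ℕ → A) : ℕ → S
  | 0 => s
  | t + 1 => f (traj f s a t) (a t)

/-- The discounted return `G(s, a) = ∑ₜ γ^t R(s_{t+1}, a_t)`. -/
noncomputable def ret {S A : Type*} (f : S → A → S) (R : S → A → ℝ) (γ : ℝ)
    (s : S) (a : ℕ → A) : ℝ :=
  ∑' t : ℕ, γ ^ t * R (traj f s a (t + 1)) (a t)

/-- The optimal value function `V*(s) = ⨆ₐ G(s, a)`. -/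
noncomputable def Vstar {S A : Type*} (f : S → A → S) (R : S → A → ℝ) (γ : ℝ)
    (s : S) : ℝ :=
  ⨆ a : ℕ → A, ret f R γ s a

/-- The optimal Q-function `Q*(s, a₀) = ⨆ {G(s, a) : a 0 = a₀}`. -/
noncomputable def Qstar {S A : Type*} (f : S → A → S) (R : S → A → ℝ) (γ : ℝ)
    (s : S) (a₀ : A) : ℝ :=
  ⨆ a : {a : ℕ → A // a 0 = a₀}, ret f R γ s (a : ℕ → A)

open Classical

/-- The stage-1 return `G₁(s,a)`: if the stage-transition time
`T = inf {t : s_t ∉ S₁}` is finite,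
`G₁(s,a) = ∑_{t<T} γ^t R(s_{t+1}, a_t) + γ^T V(s_T)` (where `V` plays the role of the
value function of the next stage); otherwise `G₁(s,a) = G(s,a)`. -/
noncomputable def stageRet {S A : Type*} (f : S → A → S) (R : S → A → ℝ) (γ : ℝ)
    (V : S → ℝ) (S₁ : Set S) (s : S) (a : ℕ → A) : ℝ :=
  if ∃ t, traj f s a t ∉ S₁ then
    (∑ t ∈ Finset.range (sInf {t | traj f s a t ∉ S₁}),
        γ ^ t * R (traj f s a (t + 1)) (a t)) +
      γ ^ (sInf {t | traj f s a t ∉ S₁}) * V (traj f s a (sInf {t | traj f s a t ∉ S₁}))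
  else ret f R γ s a

/-- The stage-1 optimal Q-function `Q*₁(s, a₀) = ⨆ {G₁(s, a) : a 0 = a₀}`. -/
noncomputable def stageQ {S A : Type*} (f : S → A → S) (R : S → A → ℝ) (γ : ℝ)
    (V : S → ℝ) (S₁ : Set S) (s : S) (a₀ : A) : ℝ :=
  ⨆ a : {a : ℕ → A // a 0 = a₀}, stageRet f R γ V S₁ s (a : ℕ → A)

lemma traj_congr {S A : Type*} (f : S → A → S) (s : S) {a b : ℕ → A} {n : ℕ}
    (h : ∀ t < n, a t = b t) : traj f s a n = traj f s b n := by
  induction n with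
  | zero => rfl
  | succ n ih =>
    simp only [traj]
    rw [ih fun t ht => h t (by omega), h n (by omega)]

lemma traj_add {S A : Type*} (f : S → A → S) (s : S) (a : ℕ → A) (n t : ℕ) :
    traj f s a (t + n) = traj f (traj f s a n) (fun k => a (k + n)) t := by
  induction t with
  | zero => simp [traj]
  | succ t ih => rw [Nat.add_right_comm]; simp only [traj, ih]

section Return

variable {S A : Type*} (f : S → A → S) {R : S → A → ℝ} {γ C : ℝ}

lemma norm_discounted_reward_le (hR : ∀ s a, |R s a| ≤ C) (hγ0 : 0 ≤ γ)
    (s : S) (a : ℕ → A) (t : ℕ) :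
    ‖γ ^ t * R (traj f s a (t + 1)) (a t)‖ ≤ γ ^ t * C := by
  rw [norm_mul, Real.norm_of_nonneg (pow_nonneg hγ0 t)]
  exact mul_le_mul_of_nonneg_left (hR _ _) (pow_nonneg hγ0 t)

lemma summable_discounted_reward (hR : ∀ s a, |R s a| ≤ C) (hγ0 : 0 ≤ γ) (hγ1 : γ < 1)
    (s : S) (a : ℕ → A) :
    Summable fun t : ℕ => γ ^ t * R (traj f s a (t + 1)) (a t) :=
  .of_norm_bounded ((summable_geometric_of_lt_one hγ0 hγ1).mul_right C)
    (norm_discounted_reward_le f hR hγ0 s a)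

lemma ret_le (hR : ∀ s a, |R s a| ≤ C) (hγ0 : 0 ≤ γ) (hγ1 : γ < 1) (s : S) (a : ℕ → A) :
    ret f R γ s a ≤ ∑' t : ℕ, γ ^ t * C :=
  (summable_discounted_reward f hR hγ0 hγ1 s a).tsum_le_tsum
    (fun t => (le_abs_self _).trans (norm_discounted_reward_le f hR hγ0 s a t))
    ((summable_geometric_of_lt_one hγ0 hγ1).mul_right C)

lemma bddAbove_range_ret (hR : ∀ s a, |R s a| ≤ C) (hγ0 : 0 ≤ γ) (hγ1 : γ < 1) (s : S) :
    BddAbove (Set.range (ret f R γ s)) :=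
  ⟨_, Set.forall_mem_range.2 (ret_le f hR hγ0 hγ1 s)⟩

lemma ret_le_Vstar (hR : ∀ s a, |R s a| ≤ C) (hγ0 : 0 ≤ γ) (hγ1 : γ < 1)
    (s : S) (a : ℕ → A) : ret f R γ s a ≤ Vstar f R γ s :=
  le_ciSup (bddAbove_range_ret f hR hγ0 hγ1 s) a

lemma ret_le_Qstar (hR : ∀ s a, |R s a| ≤ C) (hγ0 : 0 ≤ γ) (hγ1 : γ < 1)
    (s : S) {a : ℕ → A} {a₀ : A} (ha : a 0 = a₀) : ret f R γ s a ≤ Qstar f R γ s a₀ :=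
  le_ciSup (f := fun a : {a : ℕ → A // a 0 = a₀} => ret f R γ s a)
    ((bddAbove_range_ret f hR hγ0 hγ1 s).mono
      (Set.range_subset_iff.2 fun b => Set.mem_range_self b.1)) ⟨a, ha⟩

/-- The return splits at time `n` into the first `n` rewards and the discounted return of the
remaining trajectory. -/
lemma ret_eq_sum_add (hR : ∀ s a, |R s a| ≤ C) (hγ0 : 0 ≤ γ) (hγ1 : γ < 1)
    (s : S) (a : ℕ → A) (n : ℕ) :
    ret f R γ s a = ∑ t ∈ Finset.range n, γ ^ t * R (traj f s a (t + 1)) (a t) +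
      γ ^ n * ret f R γ (traj f s a n) (fun k => a (k + n)) := by
  rw [ret, ← (summable_discounted_reward f hR hγ0 hγ1 s a).sum_add_tsum_nat_add n, ret,
    ← tsum_mul_left]
  congr 1
  refine tsum_congr fun t => ?_
  rw [← traj_add, Nat.add_right_comm, pow_add]
  ring

/-- Following `a` for `n ≥ 1` steps and then acting optimally is worth at most `Q*`. -/
lemma sum_add_Vstar_le_Qstar [Nonempty A] (hR : ∀ s a, |R s a| ≤ C) (hγ0 : 0 ≤ γ)
    (hγ1 : γ < 1) (s : S) {a : ℕ → A} {a₀ : A} (ha : a 0 = a₀) {n : ℕ} (hn : 0 < n) :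
    ∑ t ∈ Finset.range n, γ ^ t * R (traj f s a (t + 1)) (a t) +
      γ ^ n * Vstar f R γ (traj f s a n) ≤ Qstar f R γ s a₀ := by
  rw [Vstar, Real.mul_iSup_of_nonneg (pow_nonneg hγ0 n), ← le_sub_iff_add_le']
  refine ciSup_le fun b => ?_
  rw [le_sub_iff_add_le']
  let c : ℕ → A := fun t => if t < n then a t else b (t - n)
  have hca : ∀ t < n, c t = a t := fun t ht => if_pos ht
  have hcb : (fun k => c (k + n)) = b := by
    funext k
    simp [c]
  refine le_trans (le_of_eq ?_) (ret_le_Qstar f hR hγ0 hγ1 s ((hca 0 hn).trans ha))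
  rw [ret_eq_sum_add f hR hγ0 hγ1 s c n, hcb, traj_congr f s hca]
  congr 1
  refine Finset.sum_congr rfl fun t ht => ?_
  rw [Finset.mem_range] at ht
  rw [hca t ht, traj_congr f s (fun k hk => hca k (by omega) : ∀ k < t + 1, c k = a k)]

lemma ret_le_stageRet (hR : ∀ s a, |R s a| ≤ C) (hγ0 : 0 ≤ γ) (hγ1 : γ < 1)
    (S₁ : Set S) (s : S) (a : ℕ → A) :
    ret f R γ s a ≤ stageRet f R γ (Vstar f R γ) S₁ s a := by
  unfold stageRet
  split_ifs with h
  · rw [ret_eq_sum_add f hR hγ0 hγ1 s a (sInf {t | traj f s a t ∉ S₁})]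
    gcongr
    exact ret_le_Vstar f hR hγ0 hγ1 _ _
  · exact le_rfl

lemma stageRet_le_Qstar [Nonempty A] (hR : ∀ s a, |R s a| ≤ C) (hγ0 : 0 ≤ γ) (hγ1 : γ < 1)
    {S₁ : Set S} {s : S} (hs : s ∈ S₁) {a : ℕ → A} {a₀ : A} (ha : a 0 = a₀) :
    stageRet f R γ (Vstar f R γ) S₁ s a ≤ Qstar f R γ s a₀ := by
  unfold stageRet
  split_ifs with h
  · refine sum_add_Vstar_le_Qstar f hR hγ0 hγ1 s ha (Nat.pos_of_ne_zero fun h0 => ?_)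
    have hmem := Nat.sInf_mem (s := {t | traj f s a t ∉ S₁}) h
    rw [h0] at hmem
    exact hmem hs
  · exact ret_le_Qstar f hR hγ0 hγ1 s ha

end Return

/-- (Two-stage consistency lemma.) With the stage-1 return defined
via the stage-transition reward `γ^T V*(s_T)`, the stage-1 optimal Q-function agrees
with the optimal Q-function of the whole problem on `S₁`:
for every `s ∈ S₁` and action `a₀`, `Q*₁(s, a₀) = Q*(s, a₀)`. -/
theorem two_stage_consistency {S A : Type*} [Nonempty A]
    (f : S → A → S) (R : S → A → ℝ) (γ C : ℝ)
    (hC : 0 ≤ C) (hR : ∀ s a, |R s a| ≤ C)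
    (hγ0 : 0 ≤ γ) (hγ1 : γ < 1) (S₁ : Set S)
    (htrans : ∀ s ∈ S₁, ∀ a : A, f s a ∈ S₁ ∨ f s a ∉ S₁) :
    ∀ s ∈ S₁, ∀ a₀ : A,
      stageQ f R γ (Vstar f R γ) S₁ s a₀ = Qstar f R γ s a₀ := by
  intro s hs a₀
  have : Nonempty {a : ℕ → A // a 0 = a₀} := ⟨⟨fun _ => a₀, rfl⟩⟩
  exact le_antisymm (ciSup_le fun a => stageRet_le_Qstar f hR hγ0 hγ1 hs a.2)
    (ciSup_mono ⟨_, Set.forall_mem_range.2 fun a => stageRet_le_Qstar f hR hγ0 hγ1 hs a.2⟩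
      fun a => ret_le_stageRet f hR hγ0 hγ1 S₁ s a)
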